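/- arXiv:math/9901033 — 4 statements merged into one kernel-verified Lean document; each statement's English description precedes it below -/
import Mathlib

section
/- Let ν ≥ 4 and q ≥ 1 be integers and let α, β, γ ∈ ℂ. Suppose that, as multisets over ℂ, the multiset consisting of −i for i = 1, …, ν−3 together with −α, −β, −γ equals the multiset consisting of −i + (1−q) for i = 1, …, ν−3 together with α−(ν−3)−q, β−(ν−3)−q, γ−(ν−3)−q. Then (ν−3+q)·(βγ + γα + αβ) = (1 + (q−1)!·(ν−3)!/(ν+q−4)!)·αβγ + (ν−3+q)²·(α+β+γ) − (ν−3+q)³. -/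
/-- The product of the negatives of `p + 1, …, p + n` is `(-1) ^ n * (p + n)! / p !`. -/
lemma prod_map_range_neg_add_mul_factorial {R : Type*} [CommRing R] (n p : ℕ) :
    ((Multiset.range n).map (fun i : ℕ => -((i : R) + 1) - p)).prod * (p.factorial : R) =
      (-1) ^ n * ((n + p).factorial : R) := by
  induction n with
  | zero => simp
  | succ k ih =>
    rw [Multiset.range_succ, Multiset.map_cons, Multiset.prod_cons, mul_assoc, ih,
      Nat.add_right_comm, Nat.factorial_succ]
    push_cast
    ring

/-- Under the root-multiset symmetry (4.5) of the paper, with `ν ≥ 4`, `q ≥ 1`: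
`(ν−3+q)·(βγ+γα+αβ) = (1 + (q−1)!·(ν−3)!/(ν+q−4)!)·αβγ + (ν−3+q)²·(α+β+γ) − (ν−3+q)³`. -/
theorem stmt_4 (ν q : ℕ) (hν : 4 ≤ ν) (hq : 1 ≤ q) (α β γ : ℂ)
    (h : (Multiset.range (ν - 3)).map (fun i => -((i : ℂ) + 1)) + {-α, -β, -γ} =
      (Multiset.range (ν - 3)).map (fun i => -((i : ℂ) + 1) + (1 - (q : ℂ))) +
        {α - ((ν : ℂ) - 3) - q, β - ((ν : ℂ) - 3) - q, γ - ((ν : ℂ) - 3) - q}) :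
    ((ν : ℂ) - 3 + q) * (β * γ + γ * α + α * β) =
      (1 + ((q - 1).factorial : ℂ) * ((ν - 3).factorial : ℂ) / ((ν + q - 4).factorial : ℂ)) *
          (α * β * γ) +
        ((ν : ℂ) - 3 + q) ^ 2 * (α + β + γ) - ((ν : ℂ) - 3 + q) ^ 3 := by
  obtain ⟨n, rfl⟩ := Nat.exists_eq_add_of_le' (show 3 ≤ ν by omega)
  obtain ⟨p, rfl⟩ := Nat.exists_eq_add_of_le' hq
  have hprod := congrArg Multiset.prod h
  have h₀ := prod_map_range_neg_add_mul_factorial (R := ℂ) n 0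
  have h₁ := prod_map_range_neg_add_mul_factorial (R := ℂ) n p
  have hshift : ∀ i : ℕ, -((i : ℂ) + 1) + (1 - ((p + 1 : ℕ) : ℂ)) = -((i : ℂ) + 1) - p := by
    intro i
    push_cast
    ring
  have hcast : (Multiset.range n >>= fun a => pure (a : ℂ)) =
      (Multiset.range n).map (fun i : ℕ => (i : ℂ)) := by
    rw [bind_pure_comp, Multiset.fmap_def]
  simp only [Nat.add_sub_cancel, hcast, Multiset.map_map, Function.comp_def, hshift,
    Multiset.prod_add, Multiset.insert_eq_cons, Multiset.prod_cons,
    Multiset.prod_singleton] at hprod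
  simp only [Nat.cast_zero, sub_zero, Nat.factorial_zero, Nat.cast_one, mul_one, add_zero] at h₀
  rw [h₀] at hprod
  have hsign : ((-1 : ℂ) ^ n) ≠ 0 := pow_ne_zero _ (by norm_num)
  have hfac : ((n + p).factorial : ℂ) ≠ 0 := Nat.cast_ne_zero.mpr (Nat.factorial_ne_zero _)
  rw [show n + 3 + (p + 1) - 4 = n + p by omega, Nat.add_sub_cancel, Nat.add_sub_cancel]
  push_cast at hprod ⊢
  have key : (n.factorial : ℂ) * p.factorial * (-α * (-β * -γ)) =
      (n + p).factorial * ((α - (n + 3 - 3) - (p + 1)) *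
        ((β - (n + 3 - 3) - (p + 1)) * (γ - (n + 3 - 3) - (p + 1)))) := by
    apply mul_left_cancel₀ hsign
    linear_combination (p.factorial : ℂ) * hprod +
      ((α - (n + 3 - 3) - (p + 1)) *
        ((β - (n + 3 - 3) - (p + 1)) * (γ - (n + 3 - 3) - (p + 1)))) * h₁
  field_simp
  linear_combination key
end

section
/- Let ν ≥ 4 and q ≥ 1 be integers, let α, β, γ ∈ ℂ, and let d ∈ ℂ satisfy d·αβγ = ν(ν−1)(ν−2). Suppose that, as multisets over ℂ, the multiset consisting of −i for i = 1, …, ν−3 together with −α, −β, −γ equals the multiset consisting of −i + (1−q) for i = 1, …, ν−3 together with α−(ν−3)−q, β−(ν−3)−q, γ−(ν−3)−q. Then (d/(ν(ν−1)))·(1 + σ₁ + σ₂ + σ₃) = ((ν−2+q)(qν−2q+2)/(2ν(ν−1)))·d + ((ν−2)/(ν−3+q))·(ν−2+q + (q−1)!·(ν−3)!/(ν+q−4)!), where σ₁ = α+β+γ, σ₂ = βγ+γα+αβ and σ₃ = αβγ. -/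
open Finset in
theorem factorial_mul_prod_range_add_one_add (k n : ℕ) :
    (k.factorial : ℂ) * ∏ i ∈ range n, ((i : ℂ) + 1 + k) = ((n + k).factorial : ℂ) := by
  induction n with
  | zero => simp
  | succ n ih =>
    rw [prod_range_succ, ← mul_assoc, ih, Nat.add_right_comm, Nat.factorial_succ]
    push_cast
    ring

/-- Computation (4.8) of the paper: with `ν ≥ 4`, `q ≥ 1`, `d·αβγ = ν(ν−1)(ν−2)` and the
root-multiset symmetry (4.5), we have
`(d/(ν(ν−1)))·(1 + σ₁ + σ₂ + σ₃) = ((ν−2+q)(qν−2q+2)/(2ν(ν−1)))·d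
  + ((ν−2)/(ν−3+q))·(ν−2+q + (q−1)!·(ν−3)!/(ν+q−4)!)`. -/
theorem stmt_5 (ν q : ℕ) (hν : 4 ≤ ν) (hq : 1 ≤ q) (α β γ d : ℂ)
    (hd : d * (α * β * γ) = (ν : ℂ) * ((ν : ℂ) - 1) * ((ν : ℂ) - 2))
    (h : (Multiset.range (ν - 3)).map (fun i => -((i : ℂ) + 1)) + {-α, -β, -γ} =
      (Multiset.range (ν - 3)).map (fun i => -((i : ℂ) + 1) + (1 - (q : ℂ))) +
        {α - ((ν : ℂ) - 3) - q, β - ((ν : ℂ) - 3) - q, γ - ((ν : ℂ) - 3) - q}) :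
    (d / ((ν : ℂ) * ((ν : ℂ) - 1))) *
        (1 + (α + β + γ) + (β * γ + γ * α + α * β) + α * β * γ) =
      (((ν : ℂ) - 2 + q) * ((q : ℂ) * ν - 2 * q + 2) / (2 * (ν : ℂ) * ((ν : ℂ) - 1))) * d +
        (((ν : ℂ) - 2) / ((ν : ℂ) - 3 + q)) *
          ((ν : ℂ) - 2 + q +
            ((q - 1).factorial : ℂ) * ((ν - 3).factorial : ℂ) / ((ν + q - 4).factorial : ℂ)) := by
  obtain ⟨n, rfl⟩ : ∃ n, ν = n + 3 := ⟨ν - 3, by omega⟩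
  obtain ⟨k, rfl⟩ : ∃ k, q = k + 1 := ⟨q - 1, by omega⟩
  rw [show n + 3 - 3 = n by omega, show k + 1 - 1 = k by omega,
    show n + 3 + (k + 1) - 4 = n + k by omega]
  rw [show n + 3 - 3 = n by omega] at h
  simp only [Multiset.bind_def, Multiset.pure_def, Multiset.bind_singleton, Multiset.map_map,
    Function.comp_def] at h
  have hsum := congrArg Multiset.sum h
  have hprod := congrArg (fun s => (s.map (fun x : ℂ => -x)).prod) h
  simp only [Multiset.map_add, Multiset.sum_add, Multiset.prod_add, Multiset.map_map,
    Function.comp_def, Multiset.insert_eq_cons, Multiset.map_cons, Multiset.map_singleton,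
    Multiset.sum_cons, Multiset.prod_cons, Multiset.sum_singleton, Multiset.prod_singleton,
    Multiset.sum_map_add, Multiset.map_const', Multiset.sum_replicate, Multiset.card_range,
    nsmul_eq_mul, neg_neg] at hsum hprod
  have hσ : 2 * (α + β + γ) = n * k + 3 * (n + k + 1) := by
    push_cast at hsum
    linear_combination -hsum
  have hleft : ((Multiset.range n).map fun i : ℕ => (i : ℂ) + 1).prod = n.factorial := by
    simpa [Finset.prod] using factorial_mul_prod_range_add_one_add 0 n
  have hright : (k.factorial : ℂ) *
      ((Multiset.range n).map fun i : ℕ => -(-((i : ℂ) + 1) + (1 - ((k + 1 : ℕ) : ℂ)))).prod =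
        (n + k).factorial := by
    rw [← factorial_mul_prod_range_add_one_add k n]
    congr 2
    refine Multiset.map_congr rfl fun i _ => ?_
    push_cast
    ring
  have hF : ((n + k).factorial : ℂ) ≠ 0 := Nat.cast_ne_zero.mpr (Nat.factorial_ne_zero _)
  rw [hleft] at hprod
  obtain ⟨r, hr⟩ : ∃ r : ℂ, (k.factorial : ℂ) * n.factorial / (n + k).factorial = r := ⟨_, rfl⟩
  rw [hr]
  rw [div_eq_iff hF] at hr
  push_cast at hd hprod hright ⊢
  have hP : r * (α * β * γ) =
      (n + k + 1 - α) * (n + k + 1 - β) * (n + k + 1 - γ) := by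
    apply mul_right_cancel₀ hF
    linear_combination (k.factorial : ℂ) * hprod - α * β * γ * hr +
      (n + k + 1 - α) * (n + k + 1 - β) * (n + k + 1 - γ) * hright
  have hm : (n : ℂ) + k + 1 ≠ 0 := by exact_mod_cast Nat.succ_ne_zero (n + k)
  have hn3 : (n : ℂ) + 3 ≠ 0 := by exact_mod_cast Nat.succ_ne_zero (n + 2)
  have hn2 : (n : ℂ) + 2 ≠ 0 := by exact_mod_cast Nat.succ_ne_zero (n + 1)
  rw [show (n : ℂ) + 3 - 1 = n + 2 by ring, show (n : ℂ) + 3 - 2 = n + 1 by ring] at *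
  rw [show (n : ℂ) + 3 - 3 + (k + 1) = n + k + 1 by ring]
  field_simp
  linear_combination (n + k + 1) * (n + k + 2) * d * hσ - 2 * d * hP
    + 2 * (n + k + 2 + r) * hd
end

section
/- Let ν ≥ 2 be an integer, let q and d be positive integers, and let α ∈ ℂ satisfy d·α = ν. Suppose that, as multisets over ℂ, the multiset consisting of −i for i = 1, …, ν−1 together with −α equals the multiset consisting of −i + (1−q) for i = 1, …, ν−1 together with α−(ν−1)−q. Then α = qν/2 and q·d = 2; consequently (q, d) = (2, 1) or (q, d) = (1, 2). -/
/-- Section 6 of the paper: let `ν ≥ 2`, `q, d` positive integers, `α ∈ ℂ` with `d·α = ν`.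
If `{−1, …, −(ν−1), −α} = {−1+(1−q), …, −(ν−1)+(1−q), α−(ν−1)−q}` as multisets over ℂ,
then `α = qν/2` and `q·d = 2`; consequently `(q, d) = (2, 1)` or `(q, d) = (1, 2)`. -/
theorem stmt_10 (ν q d : ℕ) (hν : 2 ≤ ν) (hq : 0 < q) (hd : 0 < d) (α : ℂ)
    (hα : (d : ℂ) * α = (ν : ℂ))
    (h : (Multiset.range (ν - 1)).map (fun i => -((i : ℂ) + 1)) + {-α} =
      (Multiset.range (ν - 1)).map (fun i => -((i : ℂ) + 1) + (1 - (q : ℂ))) +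
        {α - ((ν : ℂ) - 1) - q}) :
    α = (q : ℂ) * ν / 2 ∧ q * d = 2 ∧ ((q, d) = (2, 1) ∨ (q, d) = (1, 2)) := by
  have hsum := congrArg Multiset.sum h
  have hcast : ((ν - 1 : ℕ) : ℂ) = (ν : ℂ) - 1 := by
    rw [Nat.cast_sub (by omega), Nat.cast_one]
  simp only [Multiset.bind_def, Multiset.pure_def, Multiset.bind_singleton, Multiset.card_map,
    Multiset.sum_add, Multiset.sum_singleton, Multiset.sum_map_add,
    Multiset.map_const', Multiset.sum_replicate, Multiset.card_range, nsmul_eq_mul,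
    hcast] at hsum
  have hα' : α = (q : ℂ) * ν / 2 := by linear_combination (-1 / 2 : ℂ) * hsum
  have hν0 : (ν : ℂ) ≠ 0 := Nat.cast_ne_zero.mpr (by omega)
  have hqd : q * d = 2 := by
    have hqd' : (q : ℂ) * d = 2 := by
      apply mul_right_cancel₀ hν0
      linear_combination 2 * hα - 2 * (d : ℂ) * hα'
    exact_mod_cast hqd'
  refine ⟨hα', hqd, ?_⟩
  have hq2 : q ≤ 2 := Nat.le_of_dvd two_pos ⟨d, hqd.symm⟩
  simp only [Prod.mk.injEq]
  interval_cases q <;> omega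
end

section
/- Let n ≥ 2 be a natural number and let χ₀, χ₁, …, χ_n be rational numbers. Define P ∈ ℚ[X] by P = Σ_{i=0}^{n} (χ_i / i!) · ascPochhammer ℚ i, where ascPochhammer ℚ i = X(X+1)⋯(X+i−1), and set Q := (−1)^n · P.comp(−X) (i.e., Q(t) = (−1)^n·P(−t)). Then the coefficient of X^n in Q − P is 0, and the coefficient of X^{n−1} in Q − P equals −((n−1)·χ_n + 2·χ_{n−1}) / (n−1)!. -/
open Polynomial

theorem ascPochhammer_coeff_self (k : ℕ) : (ascPochhammer ℚ k).coeff k = 1 := by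
  simpa [ascPochhammer_natDegree] using (monic_ascPochhammer ℚ k).coeff_natDegree

/-- The `X ^ k`-coefficient of the ascending Pochhammer polynomial of degree `k + 1`. -/
theorem ascPochhammer_succ_coeff_self (k : ℕ) :
    (ascPochhammer ℚ (k + 1)).coeff k = (k : ℚ) * (k + 1) / 2 := by
  induction k with
  | zero => simp
  | succ k ih =>
    rw [ascPochhammer_succ_right, mul_add, coeff_add, coeff_mul_X, ih, ← C_eq_natCast,
      coeff_mul_C, ascPochhammer_coeff_self]
    push_cast
    ring

theorem coeff_comp_neg_X {R : Type*} [CommRing R] (p : R[X]) (k : ℕ) :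
    (p.comp (-X)).coeff k = p.coeff k * (-1) ^ k := by
  simpa using comp_C_mul_X_coeff (p := p) (r := (-1 : R)) (n := k)

/-- Computation (2.5) of the paper: with `P = Σ_{i=0}^{n} (χ_i / i!) · ascPochhammer ℚ i`
and `Q = (−1)^n · P.comp(−X)`, the `X^n`-coefficient of `Q − P` is `0` and its
`X^{n−1}`-coefficient is `−((n−1)·χ_n + 2·χ_{n−1}) / (n−1)!`. -/
theorem stmt_13 (n : ℕ) (hn : 2 ≤ n) (χ : ℕ → ℚ)
    (P Q : Polynomial ℚ)
    (hP : P = ∑ i ∈ Finset.range (n + 1), (χ i / (i.factorial : ℚ)) • ascPochhammer ℚ i)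
    (hQ : Q = (-1 : ℚ) ^ n • P.comp (-X)) :
    (Q - P).coeff n = 0 ∧
      (Q - P).coeff (n - 1) =
        -((((n : ℚ) - 1) * χ n + 2 * χ (n - 1)) / ((n - 1).factorial : ℚ)) := by
  obtain ⟨m, rfl⟩ : ∃ m, n = m + 1 := ⟨n - 1, by omega⟩
  have hs : ((-1 : ℚ) ^ m) * (-1) ^ m = 1 := by rw [← mul_pow]; simp
  have hPm : P.coeff m = χ m / (m.factorial : ℚ) +
      χ (m + 1) / ((m + 1).factorial : ℚ) * ((m : ℚ) * (m + 1) / 2) := by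
    rw [hP, finsetSum_coeff, Finset.sum_range_succ, Finset.sum_range_succ,
      Finset.sum_eq_zero, coeff_smul, coeff_smul, ascPochhammer_succ_coeff_self,
      ascPochhammer_coeff_self]
    · simp
    · intro i hi
      rw [coeff_smul, coeff_eq_zero_of_natDegree_lt, smul_zero]
      rw [ascPochhammer_natDegree]
      exact Finset.mem_range.mp hi
  subst hQ
  simp only [coeff_sub, coeff_smul, coeff_comp_neg_X, smul_eq_mul, Nat.add_sub_cancel]
  constructor
  · linear_combination P.coeff (m + 1) * hs
  · have hQm : (-1 : ℚ) ^ (m + 1) * (P.coeff m * (-1) ^ m) = -P.coeff m := by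
      linear_combination -P.coeff m * hs
    rw [hQm, hPm, Nat.factorial_succ]
    have hf : (m.factorial : ℚ) ≠ 0 := by positivity
    push_cast
    field_simp
    ring
end
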